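/- arXiv:2403.03464 — 3 statements merged into one kernel-verified Lean document; each statement's English description precedes it below -/
import Mathlib

section
/- Let G₄ be the symmetric 6×6 matrix with rows (1/2)·[2,1,1,0,1,1; 1,2,1,1,0,1; 1,1,2,1,1,2; 0,1,1,2,1,1; 1,0,1,1,2,1; 1,1,2,1,1,2] and N=(N₁,...,N₆)ᵀ. For δ₁,δ₂ ∈ {0,1}: ∑_{N₁,...,N₆≥0} z₁^{N₁+N₃-N₄-N₆} z₂^{N₂+N₃-N₅-N₆} q^{NᵀG₄N - 2δ₁(N₄+N₆) - 2δ₂(N₅+N₆)} / ∏_i (q²;q²)_{N_i} = (1/(q²;q²)_∞²) ∑_{M₁,M₂∈ℤ} z₁^{M₁} z₂^{M₂} q^{M₁²+M₂²-M₁M₂} (1+δ₁q^{2M₁})(1+δ₂q^{2M₂}). -/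
open scoped BigOperators
open Filter Topology

/-- Finite q-Pochhammer symbol $(a;q)_n$. -/
noncomputable def qPoch (q a : ℂ) (n : ℕ) : ℂ := ∏ j ∈ Finset.range n, (1 - a * q ^ j)

/-- Infinite q-Pochhammer symbol $(a;q)_\infty$. -/
noncomputable def qPochInf (q a : ℂ) : ℂ := ∏' j : ℕ, (1 - a * q ^ j)

/-- The quadratic form $N^T G_4 N$ for the $6\times 6$ matrix
$G_4=\frac12\begin{pmatrix}2&1&1&0&1&1\\1&2&1&1&0&1\\1&1&2&1&1&2\\0&1&1&2&1&1\\1&0&1&1&2&1\\1&1&2&1&1&2\end{pmatrix}$. -/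
def Q4 (n₁ n₂ n₃ n₄ n₅ n₆ : ℕ) : ℕ :=
  n₁ ^ 2 + n₂ ^ 2 + n₃ ^ 2 + n₄ ^ 2 + n₅ ^ 2 + n₆ ^ 2 +
    n₁ * n₂ + n₁ * n₃ + n₁ * n₅ + n₁ * n₆ +
    n₂ * n₃ + n₂ * n₄ + n₂ * n₆ +
    n₃ * n₄ + n₃ * n₅ + 2 * (n₃ * n₆) +
    n₄ * n₅ + n₄ * n₆ + n₅ * n₆

/-- The reciprocal `1 / (p;p)_n`, extended by zero to negative `n`. -/
noncomputable def invPoch (p : ℂ) (n : ℤ) : ℂ := if n < 0 then 0 else (qPoch p p n.toNat)⁻¹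

lemma invPoch_of_neg (p : ℂ) {n : ℤ} (hn : n < 0) : invPoch p n = 0 := by simp [invPoch, hn]

lemma invPoch_natCast (p : ℂ) (n : ℕ) : invPoch p n = (qPoch p p n)⁻¹ := by simp [invPoch]

lemma invPoch_zero (p : ℂ) : invPoch p 0 = 1 := by simp [invPoch, qPoch]

lemma one_sub_pow_succ_ne_zero {p : ℂ} (hp : ‖p‖ < 1) (k : ℕ) : 1 - p ^ (k + 1) ≠ 0 := by
  intro h
  have h1 : ‖p ^ (k + 1)‖ < 1 := by
    rw [norm_pow]; exact pow_lt_one₀ (norm_nonneg _) hp (by omega)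
  rw [← sub_eq_zero.mp h] at h1
  simp at h1

lemma invPoch_sub_one {p : ℂ} (hp : ‖p‖ < 1) (n : ℤ) :
    invPoch p (n - 1) = (1 - p ^ n) * invPoch p n := by
  rcases lt_trichotomy n 0 with hn | rfl | hn
  · rw [invPoch_of_neg p hn, invPoch_of_neg p (by omega), mul_zero]
  · rw [invPoch_of_neg p (by omega)]; simp
  · obtain ⟨k, rfl⟩ : ∃ k : ℕ, n = (k + 1 : ℕ) := ⟨(n - 1).toNat, by omega⟩
    have hk : ((k + 1 : ℕ) : ℤ) - 1 = k := by simp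
    rw [hk, invPoch_natCast, invPoch_natCast, qPoch, qPoch, Finset.prod_range_succ, zpow_natCast,
      mul_inv, ← pow_succ', mul_left_comm, mul_inv_cancel₀ (one_sub_pow_succ_ne_zero hp k), mul_one]

lemma summable_norm_neg_mul_pow {p : ℂ} (hp : ‖p‖ < 1) :
    Summable fun j : ℕ => ‖-(p * p ^ j)‖ := by
  simp only [norm_neg, norm_mul, norm_pow]
  exact (summable_geometric_of_lt_one (norm_nonneg _) hp).mul_left _

lemma qPochInf_self_ne_zero {p : ℂ} (hp : ‖p‖ < 1) : qPochInf p p ≠ 0 := by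
  have h := tprod_one_add_ne_zero_of_summable (f := fun j : ℕ => -(p * p ^ j))
    (fun j => by
      have := one_sub_pow_succ_ne_zero hp j
      rwa [pow_succ', sub_eq_add_neg] at this) (summable_norm_neg_mul_pow hp)
  simpa only [qPochInf, sub_eq_add_neg] using h

lemma tendsto_invPoch {p : ℂ} (hp : ‖p‖ < 1) :
    Tendsto (invPoch p) atTop (𝓝 (qPochInf p p)⁻¹) := by
  have h := (multipliable_one_add_of_summable (summable_norm_neg_mul_pow hp)).tendsto_prod_tprod_nat
  have h2 : Tendsto (fun n => qPoch p p n) atTop (𝓝 (qPochInf p p)) := by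
    simpa only [qPochInf, qPoch, sub_eq_add_neg] using h
  have h3 : Tendsto Int.toNat atTop atTop := tendsto_atTop.mpr fun k =>
    (eventually_ge_atTop (k : ℤ)).mono fun n hn => by omega
  refine ((h2.inv₀ (qPochInf_self_ne_zero hp)).comp h3).congr' ?_
  filter_upwards [eventually_ge_atTop 0] with n hn
  simp [invPoch, not_lt.mpr hn]

lemma exists_norm_invPoch_le {p : ℂ} (hp : ‖p‖ < 1) : ∃ K : ℝ, 0 < K ∧ ∀ n, ‖invPoch p n‖ ≤ K := by
  have h := ((tendsto_invPoch hp).comp tendsto_natCast_atTop_atTop).norm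
  obtain ⟨K, hK⟩ := h.bddAbove_range
  refine ⟨max K 1, by positivity, fun n => ?_⟩
  rcases lt_or_ge n 0 with hn | hn
  · rw [invPoch_of_neg p hn]; simp
  · lift n to ℕ using hn
    exact le_max_of_le_left (hK ⟨n, rfl⟩)

lemma summable_pow_mul_pow_sq {r s : ℝ} (hr0 : 0 < r) (hr : r < 1) (hs : 0 < s) :
    Summable fun n : ℕ => s ^ n * r ^ n ^ 2 := by
  refine summable_of_ratio_test_tendsto_lt_one (l := 0) one_pos
    (Eventually.of_forall fun n => by positivity) ?_
  have h : Tendsto (fun n : ℕ => s * r * (r ^ 2) ^ n) atTop (𝓝 (s * r * 0)) :=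
    (tendsto_pow_atTop_nhds_zero_of_lt_one (by positivity)
      (pow_lt_one₀ hr0.le hr two_ne_zero)).const_mul _
  rw [mul_zero] at h
  refine h.congr fun n => ?_
  have e : r ^ (n + 1) ^ 2 = r ^ n ^ 2 * (r ^ 2) ^ n * r := by
    rw [← pow_mul, ← pow_add, ← pow_succ]; ring_nf
  rw [Real.norm_of_nonneg (by positivity), Real.norm_of_nonneg (by positivity), e, pow_succ s n]
  field_simp

/-- The summand of the `q`-Vandermonde sum. -/
noncomputable def vandermondeTerm (p : ℂ) (a b n : ℤ) : ℂ :=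
  p ^ ((a - n) * (b - n)) * invPoch p n * invPoch p (a - n) * invPoch p (b - n)

lemma vandermondeTerm_eq_zero (p : ℂ) (a b : ℤ) {n : ℤ} (hn : n ∉ Finset.Icc 0 a) :
    vandermondeTerm p a b n = 0 := by
  rw [Finset.mem_Icc, not_and_or, not_le, not_le] at hn
  rcases hn with hn | hn
  · simp [vandermondeTerm, invPoch_of_neg p hn]
  · simp [vandermondeTerm, invPoch_of_neg p (sub_neg.mpr hn)]

lemma summable_vandermondeTerm (p : ℂ) (a b : ℤ) : Summable (vandermondeTerm p a b) :=
  summable_of_ne_finset_zero fun _ => vandermondeTerm_eq_zero p a b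

lemma one_sub_zpow_mul_vandermondeTerm {p : ℂ} (hp0 : p ≠ 0) (hp : ‖p‖ < 1) (a b n : ℤ) :
    (1 - p ^ a) * vandermondeTerm p a b n =
      p ^ ((a - n) * (b - n)) * invPoch p n * invPoch p (a - 1 - n) * invPoch p (b - n) +
      p ^ ((a - 1 - (n - 1)) * (b - (n - 1))) * invPoch p (n - 1) * invPoch p (a - 1 - (n - 1)) *
        invPoch p (b - 1 - (n - 1)) := by
  rw [show a - 1 - n = a - n - 1 by ring, invPoch_sub_one hp (a - n), invPoch_sub_one hp n,
    show a - 1 - (n - 1) = a - n by ring, show b - 1 - (n - 1) = b - n by ring,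
    show (a - n) * (b - (n - 1)) = (a - n) * (b - n) + (a - n) by ring, zpow_add₀ hp0,
    show p ^ a = p ^ (a - n) * p ^ n by rw [← zpow_add₀ hp0]; ring_nf, vandermondeTerm]
  ring

lemma vandermondeTerm_sub_one {p : ℂ} (hp0 : p ≠ 0) (hp : ‖p‖ < 1) (a b n : ℤ) :
    vandermondeTerm p (a - 1) b n =
      p ^ ((a - n) * (b - n)) * invPoch p n * invPoch p (a - 1 - n) * invPoch p (b - n) +
      p ^ ((a - 1 - n) * (b - n)) * invPoch p n * invPoch p (a - 1 - n) *
        invPoch p (b - 1 - n) := by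
  rw [show b - 1 - n = b - n - 1 by ring, invPoch_sub_one hp (b - n),
    show (a - n) * (b - n) = (a - 1 - n) * (b - n) + (b - n) by ring, zpow_add₀ hp0,
    vandermondeTerm]
  ring

lemma one_sub_zpow_mul_tsum_vandermondeTerm {p : ℂ} (hp0 : p ≠ 0) (hp : ‖p‖ < 1) (a b : ℤ) :
    (1 - p ^ a) * ∑' n, vandermondeTerm p a b n = ∑' n, vandermondeTerm p (a - 1) b n := by
  have hsupp : ∀ (g : ℤ → ℂ) (e : ℤ → ℤ), Summable fun n =>
      p ^ e n * invPoch p n * invPoch p (a - 1 - n) * g n := by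
    refine fun g e => summable_of_ne_finset_zero (s := Finset.Icc 0 (a - 1)) fun n hn => ?_
    rw [Finset.mem_Icc, not_and_or, not_le, not_le] at hn
    rcases hn with hn | hn
    · simp [invPoch_of_neg p hn]
    · simp [invPoch_of_neg p (sub_neg.mpr hn)]
  have h1 := hsupp (fun n => invPoch p (b - n)) fun n => (a - n) * (b - n)
  have h2 := hsupp (fun n => invPoch p (b - 1 - n)) fun n => (a - 1 - n) * (b - n)
  rw [← tsum_mul_left]
  simp only [one_sub_zpow_mul_vandermondeTerm hp0 hp, vandermondeTerm_sub_one hp0 hp]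
  have h3 := (Equiv.subRight (1 : ℤ)).summable_iff.mpr h2
  have h4 := (Equiv.subRight (1 : ℤ)).tsum_eq fun n =>
    p ^ ((a - 1 - n) * (b - n)) * invPoch p n * invPoch p (a - 1 - n) * invPoch p (b - 1 - n)
  simp only [Function.comp_def, Equiv.subRight_apply] at h3 h4
  rw [h1.tsum_add h2, ← h4, h1.tsum_add h3]

/-- The `q`-Chu–Vandermonde summation. -/
lemma tsum_vandermondeTerm {p : ℂ} (hp0 : p ≠ 0) (hp : ‖p‖ < 1) (a b : ℤ) :
    ∑' n, vandermondeTerm p a b n = invPoch p a * invPoch p b := by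
  rcases lt_or_ge a 0 with ha | ha
  · rw [invPoch_of_neg p ha, zero_mul]
    refine (tsum_congr fun n => vandermondeTerm_eq_zero p a b ?_).trans tsum_zero
    rw [Finset.mem_Icc]; omega
  · lift a to ℕ using ha
    induction a with
    | zero =>
      rw [tsum_eq_single 0 fun n hn => vandermondeTerm_eq_zero p _ b (by
        rw [Finset.mem_Icc]; push_cast; omega)]
      simp [vandermondeTerm, invPoch_zero]
    | succ k ih =>
      have hk : ((k + 1 : ℕ) : ℤ) - 1 = k := by simp
      have h := one_sub_zpow_mul_tsum_vandermondeTerm hp0 hp (k + 1 : ℕ) b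
      rw [hk, ih, ← hk, invPoch_sub_one hp, mul_assoc] at h
      refine mul_left_cancel₀ ?_ h
      rw [zpow_natCast]
      exact one_sub_pow_succ_ne_zero hp k

/-- The summand of the `q`-Gauss sum. -/
noncomputable def gaussTerm (p : ℂ) (M C : ℤ) : ℂ :=
  p ^ (C * (C + M)) * invPoch p C * invPoch p (C + M)

lemma summable_gaussTerm {p : ℂ} (hp0 : p ≠ 0) (hp : ‖p‖ < 1) (M : ℤ) :
    Summable (gaussTerm p M) := by
  obtain ⟨K, hK0, hK⟩ := exists_norm_invPoch_le hp
  have hr : 0 < ‖p‖ := norm_pos_iff.mpr hp0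
  refine (Nat.cast_injective.summable_iff (f := gaussTerm p M) fun C hC => ?_).mp ?_
  · rw [gaussTerm, invPoch_of_neg p]
    · simp
    · by_contra! h
      exact hC ⟨C.toNat, by simp [h]⟩
  · refine ((summable_pow_mul_pow_sq hr hp (zpow_pos hr M)).mul_right (K * K)).of_norm_bounded
      fun n => ?_
    have e : ‖p‖ ^ ((n : ℤ) * (n + M)) = (‖p‖ ^ M) ^ n * ‖p‖ ^ n ^ 2 := by
      rw [← zpow_natCast, ← zpow_natCast, ← zpow_mul, ← zpow_add₀ hr.ne']
      congr 1; push_cast; ring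
    simp only [Function.comp_apply, gaussTerm, norm_mul, norm_zpow]
    rw [e, mul_assoc]
    gcongr <;> apply hK

/-- A limiting case of the `q`-Gauss summation. -/
lemma tsum_gaussTerm {p : ℂ} (hp0 : p ≠ 0) (hp : ‖p‖ < 1) (M : ℤ) :
    ∑' C, gaussTerm p M C = (qPochInf p p)⁻¹ := by
  obtain ⟨K, hK0, hK⟩ := exists_norm_invPoch_le hp
  have hlim := tendsto_invPoch hp
  have hsum (N : ℤ) : ∑' C, invPoch p (N - C) * gaussTerm p M C =
      invPoch p N * invPoch p (N + M) := by
    rw [← tsum_vandermondeTerm hp0 hp, ← (Equiv.subLeft N).tsum_eq]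
    refine tsum_congr fun C => ?_
    rw [Equiv.subLeft_apply, vandermondeTerm, gaussTerm, sub_sub_cancel,
      show N + M - C = N - C + M by ring]
    ring
  have h1 : Tendsto (fun N : ℤ => ∑' C, invPoch p (N - C) * gaussTerm p M C) atTop
      (𝓝 (∑' C, (qPochInf p p)⁻¹ * gaussTerm p M C)) := by
    refine tendsto_tsum_of_dominated_convergence
      ((summable_gaussTerm hp0 hp M).norm.mul_left K) (fun C => ?_)
      (Eventually.of_forall fun N C => ?_)
    · exact (hlim.comp (tendsto_atTop_add_const_right _ (-C) tendsto_id)).mul_const _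
    · rw [norm_mul]
      gcongr
      apply hK
  simp only [hsum, tsum_mul_left] at h1
  have h2 := hlim.mul (hlim.comp (tendsto_atTop_add_const_right _ M tendsto_id))
  exact mul_left_cancel₀ (inv_ne_zero (qPochInf_self_ne_zero hp)) (tendsto_nhds_unique h1 h2)

lemma hasSum_gaussTerm_shift {p : ℂ} (hp0 : p ≠ 0) (hp : ‖p‖ < 1) {δ : ℤ} (hδ : δ = 0 ∨ δ = 1)
    (M : ℤ) :
    HasSum (fun C : ℤ => p ^ (C * (C + M) - δ * C) * (invPoch p C * invPoch p (C + M)))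
      ((qPochInf p p)⁻¹ * (1 + δ * p ^ M)) := by
  have h (M : ℤ) : HasSum (gaussTerm p M) (qPochInf p p)⁻¹ :=
    tsum_gaussTerm hp0 hp M ▸ (summable_gaussTerm hp0 hp M).hasSum
  rcases hδ with rfl | rfl
  · convert h M using 1
    · funext C
      simp [gaussTerm, mul_assoc]
    · simp
  · convert (h (M - 1)).add ((h M).mul_left (p ^ M)) using 1
    · funext C
      rw [gaussTerm, gaussTerm, show C + (M - 1) = C + M - 1 by ring, invPoch_sub_one hp,
        show C * (C + M) = C * (C + M - 1) + C by ring, one_mul, add_sub_cancel_right,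
        zpow_add₀ hp0, zpow_add₀ hp0]
      ring
    · push_cast; ring

/-- The summand of the sextuple sum in the variables `M₁, M₂, M₃, M₄, N₃, N₆`. -/
noncomputable def thetaVandermondeTerm (q z₁ z₂ : ℂ) (δ₁ δ₂ : ℤ) :
    (ℤ × ℤ) × (ℤ × ℤ) × (ℤ × ℤ) → ℂ
  | ((a, b), (c, d), (n, m)) =>
    z₁ ^ a * z₂ ^ b * q ^ (a ^ 2 + b ^ 2 - a * b) *
      ((q ^ 2) ^ (c * (c + a) - δ₁ * c) * (q ^ 2) ^ (d * (d + b) - δ₂ * d) *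
        (vandermondeTerm (q ^ 2) (c + a) (d + b) n * vandermondeTerm (q ^ 2) c d m))

/-- The change of variables from `N₁, …, N₆` to `M₁, M₂, M₃, M₄, N₃, N₆`. -/
def changeOfVariables (n : ℕ × ℕ × ℕ × ℕ × ℕ × ℕ) : (ℤ × ℤ) × (ℤ × ℤ) × (ℤ × ℤ) :=
  (((n.1 : ℤ) + n.2.2.1 - n.2.2.2.1 - n.2.2.2.2.2,
      (n.2.1 : ℤ) + n.2.2.1 - n.2.2.2.2.1 - n.2.2.2.2.2),
    ((n.2.2.2.1 : ℤ) + n.2.2.2.2.2, (n.2.2.2.2.1 : ℤ) + n.2.2.2.2.2),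
    (n.2.2.1, n.2.2.2.2.2))

lemma changeOfVariables_injective : Function.Injective changeOfVariables := by
  rintro ⟨a, b, c, d, e, f⟩ ⟨a', b', c', d', e', f'⟩ h
  simp only [changeOfVariables, Prod.mk.injEq] at h ⊢
  omega

lemma thetaVandermondeTerm_eq_zero (q z₁ z₂ : ℂ) (δ₁ δ₂ : ℤ) {x : (ℤ × ℤ) × (ℤ × ℤ) × (ℤ × ℤ)}
    (hx : x ∉ Set.range changeOfVariables) : thetaVandermondeTerm q z₁ z₂ δ₁ δ₂ x = 0 := by
  obtain ⟨⟨a, b⟩, ⟨c, d⟩, ⟨n, m⟩⟩ := x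
  have h : c + a - n < 0 ∨ d + b - n < 0 ∨ n < 0 ∨ c - m < 0 ∨ d - m < 0 ∨ m < 0 := by
    by_contra! h
    refine hx ⟨((c + a - n).toNat, (d + b - n).toNat, n.toNat, (c - m).toNat, (d - m).toNat,
      m.toNat), ?_⟩
    simp only [changeOfVariables, Prod.mk.injEq]
    omega
  rcases h with h | h | h | h | h | h <;>
    simp [thetaVandermondeTerm, vandermondeTerm, invPoch_of_neg _ h]

/-- The summand of the sextuple sum. -/
noncomputable def sextupleTerm (q z₁ z₂ : ℂ) (δ₁ δ₂ : ℤ) (n₁ n₂ n₃ n₄ n₅ n₆ : ℕ) : ℂ :=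
  z₁ ^ ((n₁ : ℤ) + n₃ - n₄ - n₆) * z₂ ^ ((n₂ : ℤ) + n₃ - n₅ - n₆) *
    q ^ ((Q4 n₁ n₂ n₃ n₄ n₅ n₆ : ℤ) - 2 * δ₁ * ((n₄ : ℤ) + n₆)
          - 2 * δ₂ * ((n₅ : ℤ) + n₆)) /
    (qPoch (q ^ 2) (q ^ 2) n₁ * qPoch (q ^ 2) (q ^ 2) n₂ *
      qPoch (q ^ 2) (q ^ 2) n₃ * qPoch (q ^ 2) (q ^ 2) n₄ *
      qPoch (q ^ 2) (q ^ 2) n₅ * qPoch (q ^ 2) (q ^ 2) n₆)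

lemma thetaVandermondeTerm_changeOfVariables {q : ℂ} (hq0 : q ≠ 0) (z₁ z₂ : ℂ) (δ₁ δ₂ : ℤ)
    (n : ℕ × ℕ × ℕ × ℕ × ℕ × ℕ) :
    thetaVandermondeTerm q z₁ z₂ δ₁ δ₂ (changeOfVariables n) =
      sextupleTerm q z₁ z₂ δ₁ δ₂ n.1 n.2.1 n.2.2.1 n.2.2.2.1 n.2.2.2.2.1 n.2.2.2.2.2 := by
  obtain ⟨n₁, n₂, n₃, n₄, n₅, n₆⟩ := n
  have e₁ : (n₄ : ℤ) + n₆ + (n₁ + n₃ - n₄ - n₆) - n₃ = n₁ := by ring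
  have e₂ : (n₅ : ℤ) + n₆ + (n₂ + n₃ - n₅ - n₆) - n₃ = n₂ := by ring
  have e₃ : (n₄ : ℤ) + n₆ - n₆ = n₄ := by ring
  have e₄ : (n₅ : ℤ) + n₆ - n₆ = n₅ := by ring
  set a : ℤ := n₁ + n₃ - n₄ - n₆ with ha
  set b : ℤ := n₂ + n₃ - n₅ - n₆ with hb
  have key : q ^ ((Q4 n₁ n₂ n₃ n₄ n₅ n₆ : ℤ) - 2 * δ₁ * ((n₄ : ℤ) + n₆)
      - 2 * δ₂ * ((n₅ : ℤ) + n₆)) = q ^ (a ^ 2 + b ^ 2 - a * b) *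
      ((q ^ 2) ^ (((n₄ : ℤ) + n₆) * (n₄ + n₆ + a) - δ₁ * (n₄ + n₆)) *
       (q ^ 2) ^ (((n₅ : ℤ) + n₆) * (n₅ + n₆ + b) - δ₂ * (n₅ + n₆)) *
       ((q ^ 2) ^ ((n₁ : ℤ) * n₂) * (q ^ 2) ^ ((n₄ : ℤ) * n₅))) := by
    simp only [← zpow_natCast q 2, ← zpow_mul, ← zpow_add₀ hq0]
    congr 1
    simp only [Q4, ha, hb]
    push_cast
    ring
  simp only [thetaVandermondeTerm, changeOfVariables, sextupleTerm, vandermondeTerm, ← ha, ← hb]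
  rw [e₁, e₂, e₃, e₄, key]
  simp only [invPoch_natCast, div_eq_mul_inv, mul_inv]
  ring

lemma sum_sq_le_Q4 (n₁ n₂ n₃ n₄ n₅ n₆ : ℕ) :
    n₁ ^ 2 + n₂ ^ 2 + n₃ ^ 2 + n₄ ^ 2 + n₅ ^ 2 + n₆ ^ 2 ≤ Q4 n₁ n₂ n₃ n₄ n₅ n₆ := by
  simp only [Q4, add_assoc]
  omega

lemma summable_sextupleTerm {q z₁ z₂ : ℂ} (hq : ‖q‖ < 1) (hq0 : q ≠ 0) (hz₁ : z₁ ≠ 0)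
    (hz₂ : z₂ ≠ 0) (δ₁ δ₂ : ℤ) :
    Summable fun n : ℕ × ℕ × ℕ × ℕ × ℕ × ℕ => sextupleTerm q z₁ z₂ δ₁ δ₂ n.1 n.2.1 n.2.2.1 n.2.2.2.1 n.2.2.2.2.1
      n.2.2.2.2.2 := by
  have hp : ‖q ^ 2‖ < 1 := by
    rw [norm_pow]; exact pow_lt_one₀ (norm_nonneg _) hq two_ne_zero
  obtain ⟨K, hK0, hK⟩ := exists_norm_invPoch_le hp
  have hK' (n : ℕ) : ‖qPoch (q ^ 2) (q ^ 2) n‖⁻¹ ≤ K := by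
    rw [← norm_inv, ← invPoch_natCast]; exact hK n
  have hr : 0 < ‖q‖ := norm_pos_iff.mpr hq0
  have ha : 0 < ‖z₁‖ := norm_pos_iff.mpr hz₁
  have hb : 0 < ‖z₂‖ := norm_pos_iff.mpr hz₂
  set r := ‖q‖
  set a := ‖z₁‖
  set b := ‖z₂‖
  set c := r ^ (-(2 * δ₁)) with hc
  set d := r ^ (-(2 * δ₂)) with hd
  have hc0 : 0 < c := zpow_pos hr _
  have hd0 : 0 < d := zpow_pos hr _
  have hg {s : ℝ} (hs : 0 < s) := summable_pow_mul_pow_sq hr hq hs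
  have hg0 {s : ℝ} (hs : 0 < s) : 0 ≤ fun n : ℕ => s ^ n * r ^ n ^ 2 :=
    fun n => by positivity
  have h₆ := hg (show 0 < a⁻¹ * b⁻¹ * c * d by positivity)
  have h₅ := (hg (show 0 < b⁻¹ * d by positivity)).mul_of_nonneg h₆
    (hg0 (by positivity)) fun n => by positivity
  have h₄ := (hg (show 0 < a⁻¹ * c by positivity)).mul_of_nonneg h₅
    (hg0 (by positivity)) fun n => by positivity
  have h₃ := (hg (show 0 < a * b by positivity)).mul_of_nonneg h₄
    (hg0 (by positivity)) fun n => by positivity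
  have h₂ := (hg hb).mul_of_nonneg h₃ (hg0 hb) fun n => by positivity
  have h₁ := (hg ha).mul_of_nonneg h₂ (hg0 ha) fun n => by positivity
  refine (h₁.mul_right (K * K * K * K * K * K)).of_norm_bounded fun n => ?_
  obtain ⟨n₁, n₂, n₃, n₄, n₅, n₆⟩ := n
  simp only [sextupleTerm, norm_div, norm_mul, norm_zpow]
  rw [div_eq_mul_inv]
  simp only [mul_inv]
  have hQ : r ^ ((Q4 n₁ n₂ n₃ n₄ n₅ n₆ : ℤ) - 2 * δ₁ * ((n₄ : ℤ) + n₆)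
      - 2 * δ₂ * ((n₅ : ℤ) + n₆)) ≤
      r ^ (n₁ ^ 2 + n₂ ^ 2 + n₃ ^ 2 + n₄ ^ 2 + n₅ ^ 2 + n₆ ^ 2) * c ^ (n₄ + n₆) *
        d ^ (n₅ + n₆) := by
    have e : r ^ ((Q4 n₁ n₂ n₃ n₄ n₅ n₆ : ℤ) - 2 * δ₁ * ((n₄ : ℤ) + n₆)
        - 2 * δ₂ * ((n₅ : ℤ) + n₆)) =
        r ^ Q4 n₁ n₂ n₃ n₄ n₅ n₆ * c ^ (n₄ + n₆) * d ^ (n₅ + n₆) := by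
      simp only [hc, hd, ← zpow_natCast, ← zpow_mul, ← zpow_add₀ hr.ne']
      congr 1; push_cast; ring
    rw [e]
    gcongr ?_ * _ * _
    exact pow_le_pow_of_le_one hr.le hq.le (sum_sq_le_Q4 ..)
  calc _ ≤ a ^ ((n₁ : ℤ) + n₃ - n₄ - n₆) * b ^ ((n₂ : ℤ) + n₃ - n₅ - n₆) *
        (r ^ (n₁ ^ 2 + n₂ ^ 2 + n₃ ^ 2 + n₄ ^ 2 + n₅ ^ 2 + n₆ ^ 2) * c ^ (n₄ + n₆) *
        d ^ (n₅ + n₆)) * (K * K * K * K * K * K) := by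
        gcongr <;> apply hK'
    _ = _ := by
        simp only [zpow_add₀ ha.ne', zpow_sub₀ ha.ne', zpow_add₀ hb.ne', zpow_sub₀ hb.ne',
          zpow_natCast, mul_pow, inv_pow, pow_add, div_eq_mul_inv]
        ring

lemma tsum_thetaVandermondeTerm_fiber {q : ℂ} (hq : ‖q‖ < 1) (hq0 : q ≠ 0) (z₁ z₂ : ℂ)
    {δ₁ δ₂ : ℤ} (hδ₁ : δ₁ = 0 ∨ δ₁ = 1) (hδ₂ : δ₂ = 0 ∨ δ₂ = 1) (a b : ℤ)
    (hs : Summable fun y => thetaVandermondeTerm q z₁ z₂ δ₁ δ₂ ((a, b), y)) :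
    ∑' y, thetaVandermondeTerm q z₁ z₂ δ₁ δ₂ ((a, b), y) =
      (qPochInf (q ^ 2) (q ^ 2) ^ 2)⁻¹ * (z₁ ^ a * z₂ ^ b * q ^ (a ^ 2 + b ^ 2 - a * b) *
        (1 + (δ₁ : ℂ) * q ^ (2 * a)) * (1 + (δ₂ : ℂ) * q ^ (2 * b))) := by
  have hp0 : q ^ 2 ≠ 0 := pow_ne_zero _ hq0
  have hp : ‖q ^ 2‖ < 1 := by
    rw [norm_pow]; exact pow_lt_one₀ (norm_nonneg _) hq two_ne_zero
  have hinner (c d : ℤ) : ∑' w, thetaVandermondeTerm q z₁ z₂ δ₁ δ₂ ((a, b), (c, d), w) =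
      z₁ ^ a * z₂ ^ b * q ^ (a ^ 2 + b ^ 2 - a * b) *
        ((q ^ 2) ^ (c * (c + a) - δ₁ * c) * (invPoch (q ^ 2) c * invPoch (q ^ 2) (c + a)) *
        ((q ^ 2) ^ (d * (d + b) - δ₂ * d) * (invPoch (q ^ 2) d * invPoch (q ^ 2) (d + b)))) := by
    simp only [thetaVandermondeTerm, tsum_mul_left]
    rw [← tsum_mul_tsum_of_summable_norm (summable_vandermondeTerm _ _ _).norm
      (summable_vandermondeTerm _ _ _).norm, tsum_vandermondeTerm hp0 hp,
      tsum_vandermondeTerm hp0 hp]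
    ring
  have h₁ := hasSum_gaussTerm_shift hp0 hp hδ₁ a
  have h₂ := hasSum_gaussTerm_shift hp0 hp hδ₂ b
  have hpow (k : ℤ) : (q ^ 2) ^ k = q ^ (2 * k) := by
    rw [← zpow_natCast, ← zpow_mul]; rfl
  rw [hs.tsum_prod]
  simp only [hinner, tsum_mul_left]
  rw [← tsum_mul_tsum_of_summable_norm h₁.summable.norm h₂.summable.norm, h₁.tsum_eq, h₂.tsum_eq,
    hpow, hpow, sq (qPochInf _ _), mul_inv]
  ring

/-- The general $G_4$ transform: for $\delta_1,\delta_2\in\{0,1\}$, the sextuple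
sum equals a double bilateral theta sum. -/
theorem G4_transform (q z₁ z₂ : ℂ) (hq : ‖q‖ < 1) (hq0 : q ≠ 0)
    (hz₁ : z₁ ≠ 0) (hz₂ : z₂ ≠ 0)
    (δ₁ δ₂ : ℤ) (hδ₁ : δ₁ = 0 ∨ δ₁ = 1) (hδ₂ : δ₂ = 0 ∨ δ₂ = 1) :
    (∑' n : ℕ × ℕ × ℕ × ℕ × ℕ × ℕ,
        match n with
        | (n₁, n₂, n₃, n₄, n₅, n₆) =>
          z₁ ^ ((n₁ : ℤ) + n₃ - n₄ - n₆) * z₂ ^ ((n₂ : ℤ) + n₃ - n₅ - n₆) *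
            q ^ ((Q4 n₁ n₂ n₃ n₄ n₅ n₆ : ℤ) - 2 * δ₁ * ((n₄ : ℤ) + n₆)
                  - 2 * δ₂ * ((n₅ : ℤ) + n₆)) /
            (qPoch (q ^ 2) (q ^ 2) n₁ * qPoch (q ^ 2) (q ^ 2) n₂ *
              qPoch (q ^ 2) (q ^ 2) n₃ * qPoch (q ^ 2) (q ^ 2) n₄ *
              qPoch (q ^ 2) (q ^ 2) n₅ * qPoch (q ^ 2) (q ^ 2) n₆))
      = (qPochInf (q ^ 2) (q ^ 2) ^ 2)⁻¹ *
          ∑' p : ℤ × ℤ,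
            z₁ ^ p.1 * z₂ ^ p.2 * q ^ (p.1 ^ 2 + p.2 ^ 2 - p.1 * p.2) *
              (1 + (δ₁ : ℂ) * q ^ (2 * p.1)) * (1 + (δ₂ : ℂ) * q ^ (2 * p.2)) := by
  have hcomp := thetaVandermondeTerm_changeOfVariables hq0 z₁ z₂ δ₁ δ₂
  have hsum : Summable (thetaVandermondeTerm q z₁ z₂ δ₁ δ₂) := by
    refine (changeOfVariables_injective.summable_iff fun x =>
      thetaVandermondeTerm_eq_zero q z₁ z₂ δ₁ δ₂).mp ?_
    exact (summable_sextupleTerm hq hq0 hz₁ hz₂ δ₁ δ₂).congr fun n => (hcomp n).symm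
  calc _ = ∑' n, thetaVandermondeTerm q z₁ z₂ δ₁ δ₂ (changeOfVariables n) :=
        tsum_congr fun n => (hcomp n).symm
    _ = ∑' x, thetaVandermondeTerm q z₁ z₂ δ₁ δ₂ x :=
        changeOfVariables_injective.tsum_eq <| Function.support_subset_iff'.mpr fun x =>
          thetaVandermondeTerm_eq_zero q z₁ z₂ δ₁ δ₂
    _ = ∑' p : ℤ × ℤ, ∑' y, thetaVandermondeTerm q z₁ z₂ δ₁ δ₂ (p, y) := hsum.tsum_prod
    _ = _ := by
        rw [← tsum_mul_left]
        exact tsum_congr fun p => tsum_thetaVandermondeTerm_fiber hq hq0 z₁ z₂ hδ₁ hδ₂ p.1 p.2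
          (hsum.prod_factor p)
end

section
/- G(q)G(q⁴) + q H(q)H(q⁴) = (q²;q²)_∞⁴ / ((q;q)_∞² (q⁴;q⁴)_∞²), where G(q) = 1/(q,q⁴;q⁵)_∞ and H(q) = 1/(q²,q³;q⁵)_∞ are the Rogers–Ramanujan functions. -/
open scoped BigOperators

/-- Rogers–Ramanujan function $G(q) = 1/(q,q^4;q^5)_\infty$. -/
noncomputable def RRG (q : ℂ) : ℂ := (qPochInf (q ^ 5) q * qPochInf (q ^ 5) (q ^ 4))⁻¹

/-- Rogers–Ramanujan function $H(q) = 1/(q^2,q^3;q^5)_\infty$. -/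
noncomputable def RRH (q : ℂ) : ℂ := (qPochInf (q ^ 5) (q ^ 2) * qPochInf (q ^ 5) (q ^ 3))⁻¹

open Filter Topology

/-! ### Infinite products -/

lemma summable_norm_qPoch {q : ℂ} (hq : ‖q‖ < 1) (a : ℂ) :
    Summable fun j : ℕ ↦ ‖-(a * q ^ j)‖ := by
  simpa using (summable_geometric_of_lt_one (norm_nonneg q) hq).mul_left ‖a‖

lemma multipliable_qPoch {q : ℂ} (hq : ‖q‖ < 1) (a : ℂ) :
    Multipliable fun j : ℕ ↦ 1 - a * q ^ j := by
  simpa [sub_eq_add_neg] using multipliable_one_add_of_summable (summable_norm_qPoch hq a)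

lemma one_sub_mul_pow_ne_zero {q a : ℂ} (hq : ‖q‖ < 1) (ha : ‖a‖ < 1) (j : ℕ) :
    1 - a * q ^ j ≠ 0 := by
  intro h
  have h1 : ‖a * q ^ j‖ = 1 := by rw [← sub_eq_zero.mp h, norm_one]
  rw [norm_mul, norm_pow] at h1
  nlinarith [pow_le_one₀ (n := j) (norm_nonneg q) hq.le, norm_nonneg a]

lemma qPochInf_ne_zero {q a : ℂ} (hq : ‖q‖ < 1) (ha : ‖a‖ < 1) : qPochInf q a ≠ 0 := by
  have := tprod_one_add_ne_zero_of_summable (f := fun j : ℕ ↦ -(a * q ^ j))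
    (fun j ↦ by simpa [sub_eq_add_neg] using one_sub_mul_pow_ne_zero hq ha j)
    (summable_norm_qPoch hq a)
  simpa [qPochInf, sub_eq_add_neg] using this

/-- Dissection of `(a;q)_∞` along the residue classes modulo `n`. -/
lemma qPochInf_eq_prod {q : ℂ} (hq : ‖q‖ < 1) (a : ℂ) (n : ℕ) [NeZero n] :
    qPochInf q a = ∏ r : Fin n, qPochInf (q ^ n) (a * q ^ (r : ℕ)) := by
  have hqn : ‖q ^ n‖ < 1 := by
    rw [norm_pow]; exact pow_lt_one₀ (norm_nonneg q) hq (NeZero.ne n)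
  obtain ⟨e, he⟩ : ∃ e : Fin n × ℕ ≃ ℕ, ∀ r k, e (r, k) = k * n + r :=
    ⟨(Equiv.prodComm _ _).trans (Nat.divModEquiv n).symm, fun _ _ ↦ rfl⟩
  have hterm (r : Fin n) (k : ℕ) :
      1 - a * q ^ e (r, k) = 1 - a * q ^ (r : ℕ) * (q ^ n) ^ k := by
    rw [he]; ring
  have hmul : Multipliable fun p ↦ 1 - a * q ^ e p :=
    (e.multipliable_iff (f := fun j ↦ 1 - a * q ^ j)).mpr (multipliable_qPoch hq a)
  rw [qPochInf, ← e.tprod_eq, hmul.tprod_prod' fun r ↦ ?_, tprod_fintype]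
  · simp_rw [hterm, qPochInf]
  · simp only [hterm]
    exact multipliable_qPoch hqn _

lemma qPochInf_eq_one_sub_mul {q : ℂ} (hq : ‖q‖ < 1) (a : ℂ) :
    qPochInf q a = (1 - a) * qPochInf q (a * q) := by
  rw [qPochInf, tprod_eq_zero_mul']
  · simp [qPochInf, pow_succ', mul_assoc]
  · simpa [pow_succ', mul_assoc] using multipliable_qPoch hq (a * q)

lemma qPochInf_neg_mul {q : ℂ} (hq : ‖q‖ < 1) (a : ℂ) :
    qPochInf q (-a) * qPochInf q a = qPochInf (q ^ 2) (a ^ 2) := by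
  rw [qPochInf, qPochInf, ← (multipliable_qPoch hq _).tprod_mul (multipliable_qPoch hq _), qPochInf]
  exact tprod_congr fun j ↦ by ring

/-! ### The theta series -/

/-- The theta series `∑_{n ∈ ℤ} s^{n²} zⁿ`. -/
noncomputable def thetaSeries (s z : ℂ) : ℂ := ∑' n : ℤ, s ^ (n ^ 2) * z ^ n

lemma summable_nat_thetaSeries {s z : ℂ} (hs : ‖s‖ < 1) (hs0 : s ≠ 0) (hz : z ≠ 0) :
    Summable fun n : ℕ ↦ ‖s ^ (n ^ 2) * z ^ n‖ := by
  refine summable_of_ratio_test_tendsto_lt_one zero_lt_one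
    (.of_forall fun n ↦ by simp [hs0, hz]) ?_
  have h : Tendsto (fun n : ℕ ↦ ‖s‖ * ‖z‖ * (‖s‖ ^ 2) ^ n) atTop (𝓝 (‖s‖ * ‖z‖ * 0)) :=
    (tendsto_pow_atTop_nhds_zero_of_lt_one (by positivity)
      (pow_lt_one₀ (norm_nonneg s) hs two_ne_zero)).const_mul _
  rw [mul_zero] at h
  refine h.congr fun n ↦ ?_
  have hs' : ‖s‖ ≠ 0 := norm_ne_zero_iff.mpr hs0
  have hz' : ‖z‖ ≠ 0 := norm_ne_zero_iff.mpr hz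
  simp only [norm_mul, norm_pow, norm_norm]
  rw [eq_div_iff (by positivity)]
  ring

lemma summable_norm_thetaSeries {s z : ℂ} (hs : ‖s‖ < 1) (hs0 : s ≠ 0) (hz : z ≠ 0) :
    Summable fun n : ℤ ↦ ‖s ^ (n ^ 2) * z ^ n‖ := by
  refine .of_nat_of_neg ?_ ?_
  · exact_mod_cast summable_nat_thetaSeries hs hs0 hz
  · have := summable_nat_thetaSeries hs hs0 (inv_ne_zero hz)
    simp only [neg_sq, zpow_neg, inv_pow] at this ⊢
    exact_mod_cast this

lemma thetaSeries_reflect {s z : ℂ} (hs0 : s ≠ 0) (hz : z ≠ 0) :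
    thetaSeries s z = s / z * thetaSeries s (s ^ 2 / z) := by
  rw [thetaSeries, thetaSeries, ← (Equiv.subLeft (-1 : ℤ)).tsum_eq, ← tsum_mul_left]
  refine tsum_congr fun n ↦ ?_
  have h1 : (-1 - n) ^ 2 = n ^ 2 + 2 * n + 1 := by ring
  rw [Equiv.subLeft_apply, h1, zpow_add₀ hs0, zpow_add₀ hs0, zpow_sub₀ hz, div_zpow, zpow_mul]
  simp only [zpow_ofNat, zpow_neg]
  field_simp

/-- `1/(q;q)_n`, extended by zero to negative `n`. -/
noncomputable def qFactInv (q : ℂ) (n : ℤ) : ℂ :=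
  if n < 0 then 0 else (∏ k ∈ Finset.range n.toNat, (1 - q * q ^ k))⁻¹

lemma qFactInv_natCast (q : ℂ) (n : ℕ) :
    qFactInv q n = (∏ k ∈ Finset.range n, (1 - q * q ^ k))⁻¹ := by
  simp [qFactInv]

lemma qFactInv_sub_one {q : ℂ} (hq : ‖q‖ < 1) (n : ℤ) :
    qFactInv q (n - 1) = (1 - q ^ n) * qFactInv q n := by
  rcases lt_trichotomy n 0 with h | rfl | h
  · simp [qFactInv, h, show n < 1 by omega]
  · simp [qFactInv]
  · obtain ⟨m, rfl⟩ : ∃ m : ℕ, n = m + 1 := ⟨(n - 1).toNat, by omega⟩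
    rw [add_sub_cancel_right, qFactInv_natCast, ← Nat.cast_add_one, qFactInv_natCast,
      Finset.prod_range_succ, mul_inv, zpow_natCast, pow_succ']
    field_simp [one_sub_mul_pow_ne_zero hq hq m]

lemma tendsto_prod_range_qPoch {q : ℂ} (hq : ‖q‖ < 1) (a : ℂ) :
    Tendsto (fun n : ℕ ↦ ∏ k ∈ Finset.range n, (1 - a * q ^ k)) atTop (𝓝 (qPochInf q a)) :=
  (multipliable_qPoch hq a).tendsto_prod_tprod_nat

lemma tendsto_qFactInv {q : ℂ} (hq : ‖q‖ < 1) :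
    Tendsto (qFactInv q) atTop (𝓝 (qPochInf q q)⁻¹) := by
  have h := (tendsto_prod_range_qPoch hq q).inv₀ (qPochInf_ne_zero hq hq)
  have ht : Tendsto Int.toNat atTop atTop := tendsto_atTop.mpr fun b ↦ by
    filter_upwards [eventually_ge_atTop (b : ℤ)] with n hn
    omega
  refine (h.comp ht).congr' ?_
  filter_upwards [eventually_ge_atTop 0] with n hn
  simp [qFactInv, hn.not_gt]

lemma exists_norm_qFactInv_le {q : ℂ} (hq : ‖q‖ < 1) : ∃ C, ∀ n, ‖qFactInv q n‖ ≤ C := by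
  have h := (tendsto_prod_range_qPoch hq q).inv₀ (qPochInf_ne_zero hq hq)
  obtain ⟨C, hC⟩ := (Metric.isBounded_range_of_tendsto _ h).exists_norm_le
  refine ⟨C, fun n ↦ ?_⟩
  by_cases hn : n < 0
  · simpa [qFactInv, hn] using (norm_nonneg _).trans (hC _ ⟨0, rfl⟩)
  · simpa only [qFactInv, hn, if_false] using hC _ ⟨n.toNat, rfl⟩

/-! ### The Jacobi triple product -/

lemma summable_truncated_theta (s z : ℂ) (N : ℤ) :
    Summable fun j : ℤ ↦ qFactInv (s ^ 2) (N - j) * qFactInv (s ^ 2) (N + j) *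
      (s ^ (j ^ 2) * z ^ j) := by
  refine summable_of_ne_finset_zero (s := Finset.Icc (-N) N) fun j hj ↦ ?_
  rw [Finset.mem_Icc, not_and_or] at hj
  rcases hj with h | h
  · simp [qFactInv, show N + j < 0 by omega]
  · simp [qFactInv, show N - j < 0 by omega]

lemma truncated_theta_succ {s z : ℂ} (hs : ‖s‖ < 1) (hs0 : s ≠ 0) (hz : z ≠ 0) (N : ℕ) :
    (1 - s ^ 2 * (s ^ 2) ^ (2 * N)) * (1 - s ^ 2 * (s ^ 2) ^ (2 * N + 1)) *
      ∑' j : ℤ, qFactInv (s ^ 2) ((N + 1 : ℤ) - j) * qFactInv (s ^ 2) ((N + 1 : ℤ) + j) *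
        (s ^ (j ^ 2) * z ^ j) =
    (1 - -z * s * (s ^ 2) ^ N) * (1 - -z⁻¹ * s * (s ^ 2) ^ N) *
      ∑' j : ℤ, qFactInv (s ^ 2) (N - j) * qFactInv (s ^ 2) (N + j) * (s ^ (j ^ 2) * z ^ j) := by
  set u : ℤ → ℂ := fun j ↦ qFactInv (s ^ 2) (N - j) * qFactInv (s ^ 2) (N + j) *
    (s ^ (j ^ 2) * z ^ j) with hu_def
  have hq : ‖s ^ 2‖ < 1 := by rw [norm_pow]; exact pow_lt_one₀ (norm_nonneg s) hs two_ne_zero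
  have hu : Summable u := summable_truncated_theta s z N
  have hu1 : Summable fun j ↦ u (j - 1) := ((Equiv.subRight (1 : ℤ)).summable_iff (f := u)).mpr hu
  have hu2 : Summable fun j ↦ u (j + 1) := ((Equiv.addRight (1 : ℤ)).summable_iff (f := u)).mpr hu
  have e1 : ∑' j, u (j - 1) = ∑' j, u j := (Equiv.subRight (1 : ℤ)).tsum_eq u
  have e2 : ∑' j, u (j + 1) = ∑' j, u j := (Equiv.addRight (1 : ℤ)).tsum_eq u
  have expand : (1 - -z * s * (s ^ 2) ^ N) * (1 - -z⁻¹ * s * (s ^ 2) ^ N) * ∑' j, u j =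
      ∑' j, ((1 + s ^ 2 * (s ^ 2) ^ (2 * N)) * u j + z * s * (s ^ 2) ^ N * u (j - 1) +
        z⁻¹ * s * (s ^ 2) ^ N * u (j + 1)) := by
    rw [((hu.mul_left _).add (hu1.mul_left _)).tsum_add (hu2.mul_left _),
      (hu.mul_left _).tsum_add (hu1.mul_left _), tsum_mul_left, tsum_mul_left, tsum_mul_left,
      e1, e2]
    field_simp
    ring
  rw [expand, ← tsum_mul_left]
  refine tsum_congr fun j ↦ ?_
  have hs2 : s ^ 2 ≠ 0 := pow_ne_zero 2 hs0
  have r1 : qFactInv (s ^ 2) (N - j) =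
      (1 - (s ^ 2) ^ ((N : ℤ) + 1 - j)) * qFactInv (s ^ 2) (N + 1 - j) := by
    rw [← qFactInv_sub_one hq]; congr 1; ring
  have r2 : qFactInv (s ^ 2) (N + j) =
      (1 - (s ^ 2) ^ ((N : ℤ) + 1 + j)) * qFactInv (s ^ 2) (N + 1 + j) := by
    rw [← qFactInv_sub_one hq]; congr 1; ring
  have r3 : qFactInv (s ^ 2) (N + (j - 1)) =
      (1 - (s ^ 2) ^ ((N : ℤ) + j)) * qFactInv (s ^ 2) (N + j) := by
    rw [← qFactInv_sub_one hq]; congr 1; ring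
  have r4 : qFactInv (s ^ 2) (N - (j + 1)) =
      (1 - (s ^ 2) ^ ((N : ℤ) - j)) * qFactInv (s ^ 2) (N - j) := by
    rw [← qFactInv_sub_one hq]; congr 1; ring
  have r5 : (N : ℤ) - (j - 1) = N + 1 - j := by ring
  have r6 : (N : ℤ) + (j + 1) = N + 1 + j := by ring
  have r7 : (j - 1) ^ 2 = j ^ 2 - 2 * j + 1 := by ring
  have r8 : (j + 1) ^ 2 = j ^ 2 + 2 * j + 1 := by ring
  simp only [hu_def, r3, r4, r5, r6]
  rw [r1, r2, r7, r8]
  generalize qFactInv (s ^ 2) (N + 1 - j) = A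
  generalize qFactInv (s ^ 2) (N + 1 + j) = B
  simp only [zpow_add₀ hs2, zpow_sub₀ hs2, zpow_add₀ hs0, zpow_sub₀ hs0, zpow_add₀ hz,
    zpow_sub₀ hz, zpow_natCast, pow_add, pow_one, pow_mul', zpow_mul, zpow_ofNat]
  have hX : (s ^ 2) ^ j ≠ 0 := zpow_ne_zero _ hs2
  generalize (s ^ 2) ^ j = X at *
  generalize (s ^ 2) ^ N = Y
  generalize s ^ (j ^ 2) = W
  generalize z ^ j = Z
  field_simp
  ring

lemma truncated_theta_eq_prod {s z : ℂ} (hs : ‖s‖ < 1) (hs0 : s ≠ 0) (hz : z ≠ 0) (N : ℕ) :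
    (∏ k ∈ Finset.range (2 * N), (1 - s ^ 2 * (s ^ 2) ^ k)) *
      ∑' j : ℤ, qFactInv (s ^ 2) (N - j) * qFactInv (s ^ 2) (N + j) * (s ^ (j ^ 2) * z ^ j) =
    (∏ k ∈ Finset.range N, (1 - -z * s * (s ^ 2) ^ k)) *
      ∏ k ∈ Finset.range N, (1 - -z⁻¹ * s * (s ^ 2) ^ k) := by
  induction N with
  | zero =>
    rw [tsum_eq_single 0 fun j hj ↦ ?_]
    · simp [qFactInv]
    · rcases hj.lt_or_gt with h | h <;> simp [qFactInv, h]
  | succ N ih =>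
    have h := truncated_theta_succ hs hs0 hz N
    rw [show 2 * (N + 1) = 2 * N + 1 + 1 by ring, Finset.prod_range_succ, Finset.prod_range_succ,
      Finset.prod_range_succ, Finset.prod_range_succ, Nat.cast_add_one]
    linear_combination (∏ k ∈ Finset.range (2 * N), (1 - s ^ 2 * (s ^ 2) ^ k)) * h +
      (1 - -z * s * (s ^ 2) ^ N) * (1 - -z⁻¹ * s * (s ^ 2) ^ N) * ih

/-- The Jacobi triple product identity. -/
theorem thetaSeries_eq_qPochInf {s z : ℂ} (hs : ‖s‖ < 1) (hs0 : s ≠ 0) (hz : z ≠ 0) :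
    thetaSeries s z =
      qPochInf (s ^ 2) (s ^ 2) * (qPochInf (s ^ 2) (-z * s) * qPochInf (s ^ 2) (-z⁻¹ * s)) := by
  have hq : ‖s ^ 2‖ < 1 := by rw [norm_pow]; exact pow_lt_one₀ (norm_nonneg s) hs two_ne_zero
  obtain ⟨C, hC⟩ := exists_norm_qFactInv_le hq
  have hsum : Tendsto (fun N : ℕ ↦ ∑' j : ℤ, qFactInv (s ^ 2) (N - j) * qFactInv (s ^ 2) (N + j) *
      (s ^ (j ^ 2) * z ^ j)) atTop
      (𝓝 (∑' j : ℤ, (qPochInf (s ^ 2) (s ^ 2))⁻¹ * (qPochInf (s ^ 2) (s ^ 2))⁻¹ *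
        (s ^ (j ^ 2) * z ^ j))) := by
    refine tendsto_tsum_of_dominated_convergence
      ((summable_norm_thetaSeries hs hs0 hz).mul_left (C * C)) (fun j ↦ ?_)
      (.of_forall fun N j ↦ ?_)
    · refine Tendsto.mul_const _ (Tendsto.mul ?_ ?_)
      · exact (tendsto_qFactInv hq).comp
          (tendsto_atTop_add_const_right _ (-j) tendsto_natCast_atTop_atTop)
      · exact (tendsto_qFactInv hq).comp
          (tendsto_atTop_add_const_right _ j tendsto_natCast_atTop_atTop)
    · rw [norm_mul, norm_mul]
      have := (norm_nonneg _).trans (hC 0)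
      gcongr <;> exact hC _
  have hL := ((tendsto_prod_range_qPoch hq (s ^ 2)).comp
    (tendsto_id.const_mul_atTop' two_pos)).mul hsum
  have hR := (tendsto_prod_range_qPoch hq (-z * s)).mul (tendsto_prod_range_qPoch hq (-z⁻¹ * s))
  have key := tendsto_nhds_unique (hL.congr (truncated_theta_eq_prod hs hs0 hz)) hR
  have h0 := qPochInf_ne_zero hq hq
  rw [← key, tsum_mul_left, thetaSeries]
  field_simp

/-! ### Reindexing the double series -/

/-- The lattice `ℤ²` as the union of the five cosets of an index-five sublattice. -/
def latticeEquiv : Fin 5 × (ℤ × ℤ) ≃ ℤ × ℤ where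
  toFun p := (p.2.1 + 4 * p.2.2 + (p.1 : ℕ), p.2.2 - p.2.1)
  invFun p := (((Int.divModEquiv 5) (p.1 - 4 * p.2)).2,
    (((Int.divModEquiv 5) (p.1 - 4 * p.2)).1, ((Int.divModEquiv 5) (p.1 - 4 * p.2)).1 + p.2))
  left_inv := by
    rintro ⟨t, a, b⟩
    have : a + 4 * b + (t : ℕ) - 4 * (b - a) = (Int.divModEquiv 5).symm (a, t) := by
      simp [Int.divModEquiv]; ring
    simp only [this, Equiv.apply_symm_apply]
    simp
  right_inv := by
    rintro ⟨n, m⟩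
    obtain ⟨a, t, h⟩ : ∃ a t, (Int.divModEquiv 5) (n - 4 * m) = (a, t) := ⟨_, _, rfl⟩
    have h' : n - 4 * m = a * 5 + (t : ℕ) := by
      simpa [Int.divModEquiv] using ((Equiv.symm_apply_eq _).mpr h.symm).symm
    simp only [h, Prod.mk.injEq]
    constructor <;> linarith

lemma latticeEquiv_apply (t : Fin 5) (a b : ℤ) :
    latticeEquiv (t, (a, b)) = (a + 4 * b + (t : ℕ), b - a) := rfl

lemma thetaSeries_dissection {s : ℂ} (hs : ‖s‖ < 1) (hs0 : s ≠ 0) :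
    thetaSeries s s * thetaSeries (s ^ 4) (-1) =
      ∑ t : Fin 5, s ^ ((t : ℕ) ^ 2 + (t : ℕ)) * (thetaSeries (s ^ 5) (-s ^ (1 + 2 * (t : ℕ))) *
        thetaSeries (s ^ 20) (-s ^ (4 + 8 * (t : ℕ)))) := by
  have hpow {n : ℕ} (hn : n ≠ 0) : ‖s ^ n‖ < 1 := by
    rw [norm_pow]; exact pow_lt_one₀ (norm_nonneg s) hs hn
  have hneg (n : ℕ) : -s ^ n ≠ 0 := neg_ne_zero.mpr (pow_ne_zero n hs0)
  have h5 (t : ℕ) := summable_norm_thetaSeries (hpow (n := 5) (by norm_num)) (pow_ne_zero 5 hs0)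
    (hneg (1 + 2 * t))
  have h20 (t : ℕ) := summable_norm_thetaSeries (hpow (n := 20) (by norm_num))
    (pow_ne_zero 20 hs0) (hneg (4 + 8 * t))
  have h1 := summable_norm_thetaSeries hs hs0 hs0
  have h4 := summable_norm_thetaSeries (hpow (n := 4) (by norm_num)) (pow_ne_zero 4 hs0)
    (z := -1) (by norm_num)
  have hterm (t : Fin 5) (a b : ℤ) :
      s ^ ((latticeEquiv (t, (a, b))).1 ^ 2) * s ^ (latticeEquiv (t, (a, b))).1 *
        ((s ^ 4) ^ ((latticeEquiv (t, (a, b))).2 ^ 2) * (-1) ^ (latticeEquiv (t, (a, b))).2) =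
      s ^ ((t : ℕ) ^ 2 + (t : ℕ)) *
        ((s ^ 5) ^ (a ^ 2) * (-s ^ (1 + 2 * (t : ℕ))) ^ a *
          ((s ^ 20) ^ (b ^ 2) * (-s ^ (4 + 8 * (t : ℕ))) ^ b)) := by
    have hsign : (-1 : ℂ) ^ (b - a) = (-1) ^ a * (-1) ^ b := by
      rw [zpow_sub₀ (by norm_num), div_eq_mul_inv, ← inv_zpow, inv_neg_one, mul_comm]
    have hn (n : ℕ) (k : ℤ) : (-s ^ n) ^ k = (-1) ^ k * s ^ (n * k) := by
      rw [← neg_one_mul, mul_zpow, zpow_mul, zpow_natCast]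
    have hp (n : ℕ) (k : ℤ) : (s ^ n) ^ k = s ^ (n * k) := by
      rw [zpow_mul, zpow_natCast]
    have h : s ^ ((a + 4 * b + (t : ℕ)) ^ 2) * s ^ (a + 4 * b + (t : ℕ)) *
        s ^ (4 * (b - a) ^ 2) = s ^ ((t : ℕ) ^ 2 + (t : ℕ)) * (s ^ (5 * a ^ 2) *
          s ^ ((1 + 2 * (t : ℕ)) * a) * (s ^ (20 * b ^ 2) * s ^ ((4 + 8 * (t : ℕ)) * b))) := by
      rw [← zpow_natCast s ((t : ℕ) ^ 2 + (t : ℕ))]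
      simp only [← zpow_add₀ hs0]
      congr 1
      push_cast
      ring
    simp only [latticeEquiv_apply]
    rw [hsign, hn, hn, hp, hp, hp]
    push_cast
    linear_combination (-1) ^ a * (-1) ^ b * h
  have hprod := latticeEquiv.summable_iff.mpr (summable_mul_of_summable_norm h1 h4)
  simp only [Function.comp_def] at hprod
  rw [thetaSeries, thetaSeries, tsum_mul_tsum_of_summable_norm h1 h4, ← latticeEquiv.tsum_eq,
    hprod.tsum_prod, tsum_fintype]
  refine Finset.sum_congr rfl fun t _ ↦ ?_
  rw [thetaSeries, thetaSeries, tsum_mul_tsum_of_summable_norm (h5 t) (h20 t), ← tsum_mul_left]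
  exact tsum_congr fun p ↦ hterm t p.1 p.2

lemma two_mul_thetaSeries_eq {s : ℂ} (hs : ‖s‖ < 1) (hs0 : s ≠ 0) :
    2 * (thetaSeries (s ^ 5) (-s) * thetaSeries (s ^ 20) (-s ^ 4) +
      s ^ 2 * (thetaSeries (s ^ 5) (-s ^ 3) * thetaSeries (s ^ 20) (-s ^ 12))) =
    thetaSeries s s * thetaSeries (s ^ 4) (-1) := by
  have hneg (n : ℕ) : -s ^ n ≠ 0 := neg_ne_zero.mpr (pow_ne_zero n hs0)
  have hzero : thetaSeries (s ^ 5) (-s ^ 5) = 0 := by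
    have h := thetaSeries_reflect (pow_ne_zero 5 hs0) (hneg 5)
    have e : (s ^ 5) ^ 2 / -s ^ 5 = -s ^ 5 := by field_simp
    rw [e, div_neg, div_self (pow_ne_zero 5 hs0)] at h
    linear_combination h / 2
  have hrefl (m n k : ℕ) (h : n + k = 2 * m) :
      thetaSeries (s ^ m) (-s ^ n) = -(s ^ m / s ^ n) * thetaSeries (s ^ m) (-s ^ k) := by
    have e : (s ^ m) ^ 2 / -s ^ n = -s ^ k := by
      rw [← pow_mul, mul_comm m, ← h, pow_add, div_neg,
        mul_div_cancel_left₀ _ (pow_ne_zero n hs0)]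
    rw [thetaSeries_reflect (pow_ne_zero m hs0) (hneg n), e, div_neg]
  rw [thetaSeries_dissection hs hs0, Fin.sum_univ_five]
  norm_num
  rw [hzero, hrefl 5 7 3 (by norm_num), hrefl 5 9 1 (by norm_num), hrefl 20 28 12 (by norm_num),
    hrefl 20 36 4 (by norm_num), pow_one]
  field_simp
  ring

/-! ### Product evaluations -/

lemma qPochInf_eq_five_mul {q : ℂ} (hq : ‖q‖ < 1) :
    qPochInf q q = qPochInf (q ^ 5) q * qPochInf (q ^ 5) (q ^ 2) * qPochInf (q ^ 5) (q ^ 3) *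
      qPochInf (q ^ 5) (q ^ 4) * qPochInf (q ^ 5) (q ^ 5) := by
  rw [qPochInf_eq_prod hq q 5, Fin.prod_univ_five]
  simp [← pow_succ', ← sq]

lemma RRG_mul_qPochInf {s : ℂ} (hs : ‖s‖ < 1) (hs0 : s ≠ 0) :
    RRG (s ^ 2) * qPochInf (s ^ 2) (s ^ 2) = thetaSeries (s ^ 5) (-s) := by
  have hpow {n : ℕ} (hn : n ≠ 0) : ‖s ^ n‖ < 1 := by
    rw [norm_pow]; exact pow_lt_one₀ (norm_nonneg s) hs hn
  rw [thetaSeries_eq_qPochInf (hpow (by norm_num)) (pow_ne_zero 5 hs0) (neg_ne_zero.mpr hs0),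
    qPochInf_eq_five_mul (hpow two_ne_zero), RRG]
  have e1 : - -s * s ^ 5 = s ^ 6 := by ring
  have e2 : -(-s)⁻¹ * s ^ 5 = s ^ 4 := by field_simp
  rw [e1, e2]
  simp only [← pow_mul]
  norm_num
  have h1 : qPochInf (s ^ 10) (s ^ 2) ≠ 0 :=
    qPochInf_ne_zero (hpow (by norm_num)) (hpow (by norm_num))
  have h2 : qPochInf (s ^ 10) (s ^ 8) ≠ 0 :=
    qPochInf_ne_zero (hpow (by norm_num)) (hpow (by norm_num))
  field_simp

lemma RRH_mul_qPochInf {s : ℂ} (hs : ‖s‖ < 1) (hs0 : s ≠ 0) :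
    RRH (s ^ 2) * qPochInf (s ^ 2) (s ^ 2) = thetaSeries (s ^ 5) (-s ^ 3) := by
  have hpow {n : ℕ} (hn : n ≠ 0) : ‖s ^ n‖ < 1 := by
    rw [norm_pow]; exact pow_lt_one₀ (norm_nonneg s) hs hn
  rw [thetaSeries_eq_qPochInf (hpow (by norm_num)) (pow_ne_zero 5 hs0)
      (neg_ne_zero.mpr (pow_ne_zero 3 hs0)),
    qPochInf_eq_five_mul (hpow two_ne_zero), RRH]
  have e1 : - -s ^ 3 * s ^ 5 = s ^ 8 := by ring
  have e2 : -(-s ^ 3)⁻¹ * s ^ 5 = s ^ 2 := by field_simp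
  rw [e1, e2]
  simp only [← pow_mul]
  norm_num
  have h1 : qPochInf (s ^ 10) (s ^ 4) ≠ 0 :=
    qPochInf_ne_zero (hpow (by norm_num)) (hpow (by norm_num))
  have h2 : qPochInf (s ^ 10) (s ^ 6) ≠ 0 :=
    qPochInf_ne_zero (hpow (by norm_num)) (hpow (by norm_num))
  field_simp

lemma thetaSeries_self_mul {s : ℂ} (hs : ‖s‖ < 1) (hs0 : s ≠ 0) :
    thetaSeries s s * qPochInf (s ^ 2) (s ^ 2) = 2 * qPochInf (s ^ 4) (s ^ 4) ^ 2 := by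
  have hq : ‖s ^ 2‖ < 1 := by rw [norm_pow]; exact pow_lt_one₀ (norm_nonneg s) hs two_ne_zero
  have h := qPochInf_neg_mul hq (s ^ 2)
  rw [← pow_mul] at h
  norm_num at h
  have e1 : -s * s = -s ^ 2 := by ring
  have e2 : -s⁻¹ * s = -1 := by field_simp
  rw [thetaSeries_eq_qPochInf hs hs0 hs0, e1, e2, qPochInf_eq_one_sub_mul hq (-1), neg_one_mul, ← h]
  ring

lemma thetaSeries_neg_one_mul {s : ℂ} (hs : ‖s‖ < 1) (hs0 : s ≠ 0) :
    thetaSeries s (-1) * qPochInf (s ^ 2) (s ^ 2) = qPochInf s s ^ 2 := by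
  have h := qPochInf_eq_prod hs s 2
  rw [Fin.prod_univ_two] at h
  simp only [Fin.val_zero, Fin.val_one, pow_zero, pow_one, mul_one, ← sq] at h
  rw [thetaSeries_eq_qPochInf hs hs0 (by norm_num), h]
  norm_num
  ring

/-- One of Ramanujan's forty identities:
$G(q)G(q^4)+qH(q)H(q^4) = (q^2;q^2)_\infty^4/((q;q)_\infty^2(q^4;q^4)_\infty^2)$. -/
theorem GH_plus (q : ℂ) (hq : ‖q‖ < 1) :
    RRG q * RRG (q ^ 4) + q * RRH q * RRH (q ^ 4)
      = qPochInf (q ^ 2) (q ^ 2) ^ 4 /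
          (qPochInf q q ^ 2 * qPochInf (q ^ 4) (q ^ 4) ^ 2) := by
  rcases eq_or_ne q 0 with rfl | hq0
  · simp [RRG, RRH, qPochInf]
  obtain ⟨s, rfl⟩ := IsAlgClosed.exists_pow_nat_eq q two_pos
  have hs0 : s ≠ 0 := by rintro rfl; simp at hq0
  have hs : ‖s‖ < 1 := by
    rw [norm_pow] at hq
    exact lt_of_pow_lt_pow_left₀ 2 zero_le_one (by simpa using hq)
  have hpow {n : ℕ} (hn : n ≠ 0) : ‖s ^ n‖ < 1 := by
    rw [norm_pow]; exact pow_lt_one₀ (norm_nonneg s) hs hn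
  have key := two_mul_thetaSeries_eq hs hs0
  have hG := RRG_mul_qPochInf hs hs0
  have hH := RRH_mul_qPochInf hs hs0
  have hG4 := RRG_mul_qPochInf (hpow four_ne_zero) (pow_ne_zero 4 hs0)
  have hH4 := RRH_mul_qPochInf (hpow four_ne_zero) (pow_ne_zero 4 hs0)
  have hpsi := thetaSeries_self_mul hs hs0
  have hphi := thetaSeries_neg_one_mul (hpow four_ne_zero) (pow_ne_zero 4 hs0)
  have h2 : qPochInf (s ^ 2) (s ^ 2) ≠ 0 := qPochInf_ne_zero hq hq
  have h8 : qPochInf (s ^ 8) (s ^ 8) ≠ 0 :=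
    qPochInf_ne_zero (hpow (by norm_num)) (hpow (by norm_num))
  simp only [← pow_mul] at hG4 hH4 hphi ⊢
  norm_num at hG4 hH4 hphi ⊢
  rw [← hG, ← hH, ← hG4, ← hH4] at key
  rw [eq_div_iff (by positivity)]
  linear_combination
    qPochInf (s ^ 2) (s ^ 2) * qPochInf (s ^ 8) (s ^ 8) / 2 * key +
    thetaSeries (s ^ 4) (-1) * qPochInf (s ^ 8) (s ^ 8) / 2 * hpsi +
    qPochInf (s ^ 4) (s ^ 4) ^ 2 * hphi
end

section
/- φ(q)φ(-q⁵) - φ(-q)φ(q⁵) = 4q E(q⁴)E(q^{20}), where φ(q) = ∑_{n∈ℤ} q^{n²} and E(q) = (q;q)_∞. -/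
open scoped BigOperators

/-- Euler function $E(q) = (q;q)_\infty$. -/
noncomputable def eulerE (q : ℂ) : ℂ := ∏' j : ℕ, (1 - q * q ^ j)

/-- Ramanujan's theta function $\varphi(q) = \sum_{n\in\mathbb{Z}} q^{n^2}$. -/
noncomputable def phi (q : ℂ) : ℂ := ∑' n : ℤ, q ^ (n ^ 2)

/-- The partial products of `∏ (1 - x ^ (k + i + 1))` are bounded uniformly in `k`. -/
lemma norm_prod_one_sub_pow_le {x : ℂ} (hx : ‖x‖ < 1) (k n : ℕ) :
    ‖∏ i ∈ Finset.range n, (1 - x ^ (k + i + 1))‖ ≤ Real.exp (1 - ‖x‖)⁻¹ := by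
  have h0 := norm_nonneg x
  calc ‖∏ i ∈ Finset.range n, (1 - x ^ (k + i + 1))‖
      ≤ ∏ i ∈ Finset.range n, Real.exp (‖x‖ ^ i) := by
        rw [norm_prod]
        refine Finset.prod_le_prod (fun _ _ ↦ norm_nonneg _) fun i _ ↦ ?_
        calc ‖1 - x ^ (k + i + 1)‖ ≤ 1 + ‖x‖ ^ (k + i + 1) := by
              simpa using norm_sub_le (1 : ℂ) (x ^ (k + i + 1))
          _ ≤ ‖x‖ ^ i + 1 := by
              linarith [pow_le_pow_of_le_one h0 hx.le (show i ≤ k + i + 1 by omega)]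
          _ ≤ Real.exp (‖x‖ ^ i) := Real.add_one_le_exp _
    _ = Real.exp (∑ i ∈ Finset.range n, ‖x‖ ^ i) := (Real.exp_sum _ _).symm
    _ ≤ Real.exp (1 - ‖x‖)⁻¹ := by
        rw [← tsum_geometric_of_lt_one h0 hx, Real.exp_le_exp]
        exact (summable_geometric_of_lt_one h0 hx).sum_le_tsum _ fun _ _ ↦ by positivity

lemma summable_pow_pentagonal {x : ℂ} (hx : ‖x‖ < 1) :
    Summable fun k : ℤ ↦ (-1 : ℂ) ^ k * x ^ pentagonal k := by
  refine .of_norm ?_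
  simpa [Function.comp_def] using
    (summable_geometric_of_lt_one (norm_nonneg x) hx).comp_injective pentagonal_injective

/-- Euler's pentagonal number theorem in the open unit disc. -/
lemma eulerE_eq_tsum_pentagonal {x : ℂ} (hx : ‖x‖ < 1) :
    eulerE x = ∑' k : ℤ, (-1 : ℂ) ^ k * x ^ pentagonal k := by
  have h0 := norm_nonneg x
  have hpow : ∀ k n, ‖x ^ ((k + 1) * n) *
      ∏ i ∈ Finset.range (n + 1), (1 - x ^ (k + i + 1))‖ ≤
        ‖x‖ ^ n * Real.exp (1 - ‖x‖)⁻¹ := fun k n ↦ by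
    rw [norm_mul, norm_pow]
    exact mul_le_mul (pow_le_pow_of_le_one h0 hx.le (by nlinarith))
      (norm_prod_one_sub_pow_le hx k _) (norm_nonneg _) (by positivity)
  have hgeom := (summable_geometric_of_lt_one h0 hx).mul_right (Real.exp (1 - ‖x‖)⁻¹)
  have hpent : HasSum (fun k : ℕ ↦ (-1 : ℂ) ^ k * (x ^ pentagonal (-k) - x ^ pentagonal (k + 1)))
      (∑' k : ℤ, (-1 : ℂ) ^ k * x ^ pentagonal k) := by
    have h := (summable_pow_pentagonal hx).hasSum
    rw [← (Equiv.neg ℤ).hasSum_iff] at h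
    convert h.nat_add_neg_add_one using 2 with k
    simp [zpow_add₀, zpow_neg, ← inv_pow]
    ring
  have hprod : eulerE x = ∏' n, (1 - x ^ (n + 1)) := by simp only [eulerE, pow_succ']
  rw [hprod, ← hpent.tsum_eq]
  refine Pentagonal.tprod_one_sub_pow (tendsto_pow_atTop_nhds_zero_of_norm_lt_one hx)
    (fun k ↦ .of_norm_bounded hgeom (hpow k)) (fun k ↦ ?_) hpent.summable ?_
  · simp only [sub_eq_add_neg]
    refine multipliable_one_add_of_summable ?_
    simpa [add_assoc] using (summable_nat_add_iff (k + 1)).2 (summable_geometric_of_lt_one h0 hx)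
  · refine squeeze_zero_norm (a := fun k ↦ ‖x‖ ^ k * ∑' n, ‖x‖ ^ n * Real.exp (1 - ‖x‖)⁻¹)
      (fun k ↦ ?_) ?_
    · rw [norm_mul, norm_mul, norm_pow, norm_neg, norm_one, one_pow, one_mul, norm_pow]
      refine mul_le_mul (pow_le_pow_of_le_one h0 hx.le ?_)
        (tsum_of_norm_bounded hgeom.hasSum (hpow k)) (norm_nonneg _) (by positivity)
      rw [Nat.le_div_iff_mul_le two_pos]
      nlinarith
    · simpa using (tendsto_pow_atTop_nhds_zero_of_lt_one h0 hx).mul_const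
        (∑' n, ‖x‖ ^ n * Real.exp (1 - ‖x‖)⁻¹)

lemma summable_norm_zpow_sq {q : ℂ} (hq : ‖q‖ < 1) :
    Summable fun n : ℤ ↦ ‖q ^ (n ^ 2)‖ := by
  have h : Summable fun n : ℕ ↦ ‖q‖ ^ (n ^ 2) :=
    .of_nonneg_of_le (fun _ ↦ by positivity)
      (fun n ↦ pow_le_pow_of_le_one (norm_nonneg q) hq.le (Nat.le_self_pow two_ne_zero n))
      (summable_geometric_of_lt_one (norm_nonneg q) hq)
  apply Summable.of_nat_of_neg
  · exact_mod_cast by simpa [← zpow_natCast] using h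
  · exact_mod_cast by simpa [← zpow_natCast] using h

/-- The pairs `(m, n)` of integers, sorted by the residue `r` of `m + n` modulo `6`. -/
def residueEquiv : Fin 6 × (ℤ × ℤ) ≃ ℤ × ℤ where
  toFun p := (5 * p.2.2 + p.2.1 + (p.1 : ℕ), p.2.2 - p.2.1)
  invFun p := (Fin.ofNat 6 ((p.1 + p.2) % 6).toNat, (p.1 + p.2) / 6 - p.2, (p.1 + p.2) / 6)
  left_inv := by
    rintro ⟨r, a, b⟩
    have hr := r.isLt
    simp only [Prod.mk.injEq, Fin.ext_iff, Fin.val_ofNat]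
    omega
  right_inv := by
    rintro ⟨m, n⟩
    simp only [Prod.mk.injEq, Fin.val_ofNat]
    omega

lemma neg_one_zpow_eq_of_even_sub {m n : ℤ} (h : Even (m - n)) : (-1 : ℂ) ^ m = (-1) ^ n := by
  rw [show m = (m - n) + n by ring, zpow_add₀ (by norm_num), h.neg_one_zpow, one_mul]

/-- The alternating theta series `∑ (-1)ᵏ x ^ (6 k² + 2 r k)`. -/
noncomputable def altTheta (r : ℤ) (x : ℂ) : ℂ :=
  ∑' k : ℤ, (-1 : ℂ) ^ k * x ^ (6 * k ^ 2 + 2 * r * k)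

lemma altTheta_one {x : ℂ} (hx : ‖x‖ < 1) : altTheta 1 x = eulerE (x ^ 4) := by
  have hx4 : ‖x ^ 4‖ < 1 := by simpa using pow_lt_one₀ (norm_nonneg x) hx four_ne_zero
  rw [altTheta, eulerE_eq_tsum_pentagonal hx4, ← (Equiv.neg ℤ).tsum_eq]
  refine tsum_congr fun k ↦ ?_
  rw [← pow_mul, ← zpow_natCast, Equiv.neg_apply]
  congr 1
  · exact neg_one_zpow_eq_of_even_sub (by grind)
  · congr 1
    push_cast
    linarith [two_mul_natCast_pentagonal k]

lemma altTheta_three (x : ℂ) : altTheta 3 x = 0 := by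
  rw [← self_eq_neg, altTheta]
  conv_lhs => rw [← (Equiv.subLeft (-1 : ℤ)).tsum_eq]
  rw [← tsum_neg]
  refine tsum_congr fun k ↦ ?_
  rw [Equiv.subLeft_apply, neg_mul_eq_neg_mul]
  congr 1
  · rw [neg_one_zpow_eq_of_even_sub (n := k + 1) (by grind), zpow_add₀ (by norm_num)]
    simp
  · congr 1
    ring

lemma altTheta_five {x : ℂ} (hx0 : x ≠ 0) : altTheta 5 x = -(x ^ 4)⁻¹ * altTheta 1 x := by
  rw [altTheta, altTheta, ← tsum_mul_left, ← (Equiv.subLeft (-1 : ℤ)).tsum_eq]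
  refine tsum_congr fun k ↦ ?_
  rw [Equiv.subLeft_apply, neg_one_zpow_eq_of_even_sub (n := k + 1) (by grind),
    zpow_add₀ (by norm_num),
    show 6 * (-1 - k) ^ 2 + 2 * 5 * (-1 - k) = 6 * k ^ 2 + 2 * 1 * k - (4 : ℕ) by push_cast; ring,
    zpow_sub₀ hx0, zpow_natCast]
  ring

/-- The contribution of the residue `r` of `m + n` modulo `6`. -/
lemma residue_term_eq {q : ℂ} (hq0 : q ≠ 0) (r a b : ℤ) :
    ((-1 : ℂ) ^ (b - a) - (-1) ^ (5 * b + a + r)) *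
        (q ^ ((5 * b + a + r) ^ 2) * (q ^ 5) ^ ((b - a) ^ 2)) =
      (1 - (-1) ^ r) * q ^ (r ^ 2) * ((-1) ^ a * q ^ (6 * a ^ 2 + 2 * r * a)) *
        ((-1) ^ b * (q ^ 5) ^ (6 * b ^ 2 + 2 * r * b)) := by
  have h1 : (-1 : ℂ) ^ (b - a) = (-1) ^ a * (-1) ^ b := by
    rw [← zpow_add₀ (by norm_num)]
    exact neg_one_zpow_eq_of_even_sub (by grind)
  have h2 : (-1 : ℂ) ^ (5 * b + a + r) = (-1) ^ a * (-1) ^ b * (-1) ^ r := by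
    rw [← zpow_add₀ (by norm_num), ← zpow_add₀ (by norm_num)]
    exact neg_one_zpow_eq_of_even_sub (by grind)
  have h3 : q ^ ((5 * b + a + r) ^ 2) * (q ^ 5) ^ ((b - a) ^ 2) =
      q ^ (r ^ 2) * q ^ (6 * a ^ 2 + 2 * r * a) * (q ^ 5) ^ (6 * b ^ 2 + 2 * r * b) := by
    simp only [← zpow_natCast, ← zpow_mul, ← zpow_add₀ hq0]
    congr 1
    push_cast
    ring
  rw [h1, h2, h3]
  ring

lemma neg_zpow_sq (x : ℂ) (n : ℤ) : (-x) ^ (n ^ 2) = (-1) ^ n * x ^ (n ^ 2) := by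
  rw [← neg_one_mul, mul_zpow, neg_one_zpow_eq_of_even_sub (n := n) (by grind [Int.even_sub, Int.even_pow])]

lemma hasSum_phi_mul_phi_sub {q : ℂ} (hq : ‖q‖ < 1) :
    HasSum (fun p : ℤ × ℤ ↦
        ((-1 : ℂ) ^ p.2 - (-1) ^ p.1) * (q ^ (p.1 ^ 2) * (q ^ 5) ^ (p.2 ^ 2)))
      (phi q * phi (-q ^ 5) - phi (-q) * phi (q ^ 5)) := by
  have hq5 : ‖q ^ 5‖ < 1 := by simpa using pow_lt_one₀ (norm_nonneg q) hq (show 5 ≠ 0 by norm_num)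
  have hmul {x y : ℂ} (hx : ‖x‖ < 1) (hy : ‖y‖ < 1) :
      HasSum (fun p : ℤ × ℤ ↦ x ^ (p.1 ^ 2) * y ^ (p.2 ^ 2)) (phi x * phi y) := by
    have hx' := summable_norm_zpow_sq hx
    have hy' := summable_norm_zpow_sq hy
    rw [phi, phi, tsum_mul_tsum_of_summable_norm hx' hy']
    exact (summable_mul_of_summable_norm hx' hy').hasSum
  refine ((hmul hq (by rwa [norm_neg])).sub (hmul (by rwa [norm_neg]) hq5)).congr_fun fun p ↦ ?_
  rw [neg_zpow_sq, neg_zpow_sq]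
  ring

/-- Modular equation of degree 5:
$\varphi(q)\varphi(-q^5)-\varphi(-q)\varphi(q^5) = 4q\,E(q^4)E(q^{20})$. -/
theorem modular_deg5 (q : ℂ) (hq : ‖q‖ < 1) :
    phi q * phi (-q ^ 5) - phi (-q) * phi (q ^ 5)
      = 4 * q * eulerE (q ^ 4) * eulerE (q ^ 20) := by
  rcases eq_or_ne q 0 with rfl | hq0
  · simp
  have hq5 : ‖q ^ 5‖ < 1 := by simpa using pow_lt_one₀ (norm_nonneg q) hq (show 5 ≠ 0 by norm_num)
  have hsum := residueEquiv.hasSum_iff.2 (hasSum_phi_mul_phi_sub hq)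
  simp only [Function.comp_def] at hsum
  have hfiber (r : Fin 6) : ∑' p : ℤ × ℤ, ((-1 : ℂ) ^ (residueEquiv (r, p)).2 -
      (-1) ^ (residueEquiv (r, p)).1) * (q ^ ((residueEquiv (r, p)).1 ^ 2) *
        (q ^ 5) ^ ((residueEquiv (r, p)).2 ^ 2)) =
      (1 - (-1) ^ (r : ℕ)) * q ^ ((r : ℕ) ^ 2) * altTheta (r : ℕ) q * altTheta (r : ℕ) (q ^ 5) := by
    rw [(hsum.summable.prod_factor r).tsum_prod]
    simp only [residueEquiv, Equiv.coe_fn_mk, residue_term_eq hq0, tsum_mul_left, tsum_mul_right]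
    simp only [altTheta]
    norm_cast
  rw [← hsum.tsum_eq, hsum.summable.tsum_prod, tsum_fintype]
  simp only [hfiber, Fin.sum_univ_six]
  simp [altTheta_three, altTheta_five, hq0, altTheta_one hq, altTheta_one hq5, ← pow_mul]
  field_simp
  ring
end
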